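/- In a free N-pseudospace M, for arbitrary subsets A, B, C: A is independent from C over B if and only if cl(A ∪ B) is independent from cl(B ∪ C) over cl(B). -/

import Mathlib

/-- A *zigzag* of length `n`: consecutive terms are strictly comparable and every
interior term is either the infimum (a sink) or the supremum (a peak) of its two
neighbours. -/
def IsZigzag {V : Type*} [Lattice V] (x : ℕ → V) (n : ℕ) : Prop :=
  (∀ i < n, x i < x (i + 1) ∨ x (i + 1) < x i) ∧
  ∀ i, i + 2 ≤ n →
    (x (i + 1) < x i ∧ x (i + 1) < x (i + 2) ∧ x (i + 1) = x i ⊓ x (i + 2)) ∨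
    (x i < x (i + 1) ∧ x (i + 2) < x (i + 1) ∧ x (i + 1) = x i ⊔ x (i + 2))

/-- A *zigzag cycle* of length `2 * n`: a `2 * n`-periodic sequence satisfying the
zigzag condition at every index (i.e. indices modulo `2 * n`). -/
def IsZigzagCycle {V : Type*} [Lattice V] (x : ℕ → V) (n : ℕ) : Prop :=
  0 < n ∧ (∀ i, x (i + 2 * n) = x i) ∧
  ∀ i,
    (x (i + 1) < x i ∧ x (i + 1) < x (i + 2) ∧ x (i + 1) = x i ⊓ x (i + 2)) ∨
    (x i < x (i + 1) ∧ x (i + 2) < x (i + 1) ∧ x (i + 1) = x i ⊔ x (i + 2))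

/-- A lattice is *simply connected* if it contains no zigzag cycles. -/
def SimplyConnected (V : Type*) [Lattice V] : Prop :=
  ∀ (x : ℕ → V) (n : ℕ), ¬IsZigzagCycle x n

/-- A *free N-pseudospace* structure on a bounded lattice `M`: an `N`-geometry
(layers indexed by `-1, …, N+1` via the function `layer`, strictly monotone,
with `⊥` in layer `-1` and `⊤` in layer `N+1`) which is simply connected and such
that for all `a < b` and every layer index `s` strictly between the layers of `a`
and `b` there are infinitely many `x` in layer `s` with `a < x < b`. -/
structure FreePseudospace (N : ℕ) (M : Type*) [Lattice M] [BoundedOrder M] where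
  layer : M → ℤ
  layer_bot : layer ⊥ = -1
  layer_top : layer ⊤ = (N : ℤ) + 1
  layer_bounds : ∀ v : M, -1 ≤ layer v ∧ layer v ≤ (N : ℤ) + 1
  layer_strictMono : ∀ v w : M, v < w → layer v < layer w
  simplyConnected : SimplyConnected M
  dense_layers : ∀ a b : M, a < b → ∀ s : ℤ, layer a < s → s < layer b →
    {x : M | a < x ∧ x < b ∧ layer x = s}.Infinite

/-- A subset `A` is *closed* if it contains `⊥` and `⊤` and every zigzag whose two
endpoints lie in `A` lies entirely in `A`. -/
def ZClosed {M : Type*} [Lattice M] [BoundedOrder M] (A : Set M) : Prop :=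
  ⊥ ∈ A ∧ ⊤ ∈ A ∧
  ∀ (x : ℕ → M) (n : ℕ), IsZigzag x n → x 0 ∈ A → x n ∈ A → ∀ i ≤ n, x i ∈ A

/-- A *direct path* from `x 0` to `A`: a zigzag `x 0, …, x n` with `x i ∉ A` for
`i < n`, `x n ∈ A`, and no element of `A` strictly between `x (n-1)` and `x n`. -/
def IsDirectPath {M : Type*} [Lattice M] (x : ℕ → M) (n : ℕ) (A : Set M) : Prop :=
  IsZigzag x n ∧ (∀ i < n, x i ∉ A) ∧ x n ∈ A ∧
  ∀ y ∈ A, ¬((x (n - 1) < y ∧ y < x n) ∨ (x n < y ∧ y < x (n - 1)))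

/-- The *closure* `zcl X`: the smallest closed subset containing `X`. -/
def zcl {M : Type*} [Lattice M] [BoundedOrder M] (X : Set M) : Set M :=
  ⋂₀ {A : Set M | ZClosed A ∧ X ⊆ A}

/-- The *gate* of `X` over the closed set `A`: the set of all endpoints of direct
paths from elements of `X` to `A`. -/
def gate {M : Type*} [Lattice M] [BoundedOrder M] (X A : Set M) : Set M :=
  {y | ∃ (p : ℕ → M) (n : ℕ), p 0 ∈ X ∧ IsDirectPath p n A ∧ p n = y}

/-- A sequence `p` of length `n` *crosses* `B` if some term belongs to `cl B` or some
open interval between consecutive terms meets `cl B`. -/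
def Crosses {M : Type*} [Lattice M] [BoundedOrder M]
    (p : ℕ → M) (n : ℕ) (B : Set M) : Prop :=
  (∃ i ≤ n, p i ∈ zcl B) ∨
  ∃ i < n, ∃ y ∈ zcl B, (p i < y ∧ y < p (i + 1)) ∨ (p (i + 1) < y ∧ y < p i)

/-- `A` and `C` are *independent over* `B` if every zigzag from an element of `A` to
an element of `C` crosses `B`. -/
def Indep {M : Type*} [Lattice M] [BoundedOrder M] (A B C : Set M) : Prop :=
  ∀ (p : ℕ → M) (n : ℕ), IsZigzag p n → p 0 ∈ A → p n ∈ C → Crosses p n B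

/-- `b` is the infimum or the supremum of `a` and `c`, and differs from both. -/
def IsTurn {V : Type*} [Lattice V] (a b c : V) : Prop :=
  (b < a ∧ b < c ∧ b = a ⊓ c) ∨ (a < b ∧ c < b ∧ b = a ⊔ c)

/-- `b` lies between `a` and `c`, and differs from `c`. -/
def Between {V : Type*} [Lattice V] (a b c : V) : Prop :=
  (a ≤ b ∧ b < c) ∨ (c < b ∧ b ≤ a)

/-- Prepend a term to a sequence. -/
def consSeq {V : Type*} (a : V) (q : ℕ → V) : ℕ → V
  | 0 => a
  | i + 1 => q i

/-- No term of `p 0, …, p n` and no closed interval between consecutive terms meets `D`. -/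
def Avoids {V : Type*} [Lattice V] (D : Set V) (p : ℕ → V) (n : ℕ) : Prop :=
  (∀ i ≤ n, p i ∉ D) ∧
  ∀ i < n, ∀ d ∈ D, ¬(p i ≤ d ∧ d ≤ p (i + 1)) ∧ ¬(p (i + 1) ≤ d ∧ d ≤ p i)

/-- There is a zigzag from `x` to `y` avoiding `D`. -/
def Linked {V : Type*} [Lattice V] (D : Set V) (x y : V) : Prop :=
  ∃ (q : ℕ → V) (m : ℕ), IsZigzag q m ∧ Avoids D q m ∧ q 0 = x ∧ q m = y

/-- The endpoints of a zigzag of length at least two are incomparable. -/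
def ZigzagsSpread (V : Type*) [Lattice V] : Prop :=
  ∀ (q : ℕ → V) (n : ℕ), 2 ≤ n → IsZigzag q n → ¬q 0 ≤ q n ∧ ¬q n ≤ q 0

section Basic

variable {V : Type*} [Lattice V]

theorem IsTurn.symm {a b c : V} (h : IsTurn a b c) : IsTurn c b a := by
  rcases h with ⟨h₁, h₂, h⟩ | ⟨h₁, h₂, h⟩
  · exact Or.inl ⟨h₂, h₁, h.trans (inf_comm _ _)⟩
  · exact Or.inr ⟨h₂, h₁, h.trans (sup_comm _ _)⟩

theorem IsTurn.of_between {a a' b c c' : V} (h : IsTurn a b c) (ha : Between a a' b)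
    (hc : Between c c' b) : IsTurn a' b c' := by
  rcases h with ⟨h₁, h₂, h⟩ | ⟨h₁, h₂, h⟩
  · obtain ⟨ha, ha'⟩ : b < a' ∧ a' ≤ a :=
      ha.resolve_left fun k => (h₁.trans_le k.1).not_gt k.2
    obtain ⟨hc, hc'⟩ : b < c' ∧ c' ≤ c :=
      hc.resolve_left fun k => (h₂.trans_le k.1).not_gt k.2
    exact Or.inl ⟨ha, hc, le_antisymm (le_inf ha.le hc.le) (h ▸ inf_le_inf ha' hc')⟩
  · obtain ⟨ha', ha⟩ : a ≤ a' ∧ a' < b :=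
      ha.resolve_right fun k => (k.1.trans_le k.2).not_gt h₁
    obtain ⟨hc', hc⟩ : c ≤ c' ∧ c' < b :=
      hc.resolve_right fun k => (k.1.trans_le k.2).not_gt h₂
    exact Or.inr ⟨ha, hc, le_antisymm (h ▸ sup_le_sup ha' hc') (sup_le ha.le hc.le)⟩

theorem between_of_lt_or_gt {a b : V} (h : a < b ∨ b < a) : Between a a b :=
  h.imp (fun h => ⟨le_rfl, h⟩) fun h => ⟨h, le_rfl⟩

theorem IsTurn.lt_or_gt_left {a b c : V} (h : IsTurn a b c) : a < b ∨ b < a :=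
  h.elim (fun h => Or.inr h.1) fun h => Or.inl h.1

theorem IsTurn.of_between_left {a a' b c : V} (h : IsTurn a b c) (ha : Between a a' b) :
    IsTurn a' b c :=
  h.of_between ha (between_of_lt_or_gt h.symm.lt_or_gt_left)

theorem IsZigzag.mono {x : ℕ → V} {n m : ℕ} (h : IsZigzag x n) (hm : m ≤ n) : IsZigzag x m :=
  ⟨fun i hi => h.1 i (by omega), fun i hi => h.2 i (by omega)⟩

theorem IsZigzag.drop {x : ℕ → V} {n : ℕ} (h : IsZigzag x n) (k : ℕ) :
    IsZigzag (fun i => x (k + i)) (n - k) :=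
  ⟨fun i hi => h.1 (k + i) (by omega), fun i hi => h.2 (k + i) (by omega)⟩

theorem IsZigzag.reverse {x : ℕ → V} {n : ℕ} (h : IsZigzag x n) :
    IsZigzag (fun i => x (n - i)) n := by
  refine ⟨fun i hi => ?_, fun i hi => ?_⟩
  · have := h.1 (n - (i + 1)) (by omega)
    rw [show n - (i + 1) + 1 = n - i by omega] at this
    exact this.symm
  · have := h.2 (n - (i + 2)) (by omega)
    rw [show n - (i + 2) + 1 = n - (i + 1) by omega,
      show n - (i + 2) + 2 = n - i by omega] at this
    exact IsTurn.symm this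

theorem IsZigzag.cons {q : ℕ → V} {n : ℕ} {a : V} (h : IsZigzag q n)
    (ha : a < q 0 ∨ q 0 < a) (ht : 1 ≤ n → IsTurn a (q 0) (q 1)) :
    IsZigzag (consSeq a q) (n + 1) := by
  refine ⟨fun i hi => ?_, fun i hi => ?_⟩
  · rcases i with _ | i
    · exact ha
    · exact h.1 i (by omega)
  · rcases i with _ | i
    · exact ht (by omega)
    · exact h.2 i (by omega)

theorem IsZigzag.const (a : V) : IsZigzag (fun _ => a) 0 :=
  ⟨fun i hi => absurd hi (by omega), fun i hi => absurd hi (by omega)⟩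

theorem IsZigzag.toDual {x : ℕ → V} {n : ℕ} (h : IsZigzag x n) :
    IsZigzag (fun i => OrderDual.toDual (x i)) n :=
  ⟨fun i hi => (h.1 i hi).symm, fun i hi => (h.2 i hi).symm⟩

theorem IsZigzag.ofDual {x : ℕ → Vᵒᵈ} {n : ℕ} (h : IsZigzag x n) :
    IsZigzag (fun i => OrderDual.ofDual (x i)) n :=
  ⟨fun i hi => (h.1 i hi).symm, fun i hi => (h.2 i hi).symm⟩

/-- Two zigzags issuing from the same vertex, at which they form a turn, can be joined. -/
theorem IsZigzag.join {w v : ℕ → V} {l m : ℕ} (hw : IsZigzag w l) (hv : IsZigzag v m)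
    (h₀ : w 0 = v 0) (ht : IsTurn (w 1) (v 0) (v 1)) :
    IsZigzag (fun i => if i ≤ l then w (l - i) else v (i - l)) (l + m) := by
  refine ⟨fun i hi => ?_, fun i hi => ?_⟩
  · rcases lt_or_ge i l with hl | hl
    · simpa [hl.le, Nat.succ_le_of_lt hl] using hw.reverse.1 i hl
    · have := hv.1 (i - l) (by omega)
      rw [show i - l + 1 = i + 1 - l by omega] at this
      rcases hl.eq_or_lt with rfl | hl
      · simpa [h₀] using this
      · simpa [hl.not_ge, show ¬ i + 1 ≤ l by omega] using this
  · rcases lt_or_ge (i + 1) l with hl | hl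
    · simpa [hl.le, show i ≤ l by omega, show i + 2 ≤ l by omega] using hw.reverse.2 i hl
    · rcases hl.eq_or_lt with rfl | hl
      · simpa [h₀, IsTurn] using ht
      · have := hv.2 (i - l) (by omega)
        rw [show i - l + 1 = i + 1 - l by omega, show i - l + 2 = i + 2 - l by omega] at this
        rcases (Nat.lt_succ_iff.mp hl).eq_or_lt with rfl | hl
        · simpa [h₀] using this
        · simpa [hl.not_ge, show ¬ i + 1 ≤ l by omega, show ¬ i + 2 ≤ l by omega] using this

theorem Avoids.drop {D : Set V} {q : ℕ → V} {n : ℕ} (h : Avoids D q n) {k : ℕ} (hk : k ≤ n) :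
    Avoids D (fun i => q (k + i)) (n - k) :=
  ⟨fun i hi => h.1 (k + i) (by omega), fun i hi => h.2 (k + i) (by omega)⟩

theorem Avoids.reverse {D : Set V} {q : ℕ → V} {n : ℕ} (h : Avoids D q n) :
    Avoids D (fun i => q (n - i)) n := by
  refine ⟨fun i hi => h.1 _ (by omega), fun i hi d hd => ?_⟩
  have := h.2 (n - (i + 1)) (by omega) d hd
  rw [show n - (i + 1) + 1 = n - i by omega] at this
  exact this.symm

theorem Avoids.cons {D : Set V} {q : ℕ → V} {n : ℕ} {a : V} (h : Avoids D q n) (ha : a ∉ D)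
    (hd : ∀ d ∈ D, ¬(a ≤ d ∧ d ≤ q 0) ∧ ¬(q 0 ≤ d ∧ d ≤ a)) :
    Avoids D (consSeq a q) (n + 1) := by
  refine ⟨fun i hi => ?_, fun i hi => ?_⟩
  · rcases i with _ | i
    · exact ha
    · exact h.1 i (by omega)
  · rcases i with _ | i
    · exact hd
    · exact h.2 i (by omega)

theorem Avoids.const {D : Set V} {a : V} (ha : a ∉ D) : Avoids D (fun _ => a) 0 :=
  ⟨fun _ _ => ha, fun i hi => absurd hi (by omega)⟩

theorem Linked.symm {D : Set V} {x y : V} (h : Linked D x y) : Linked D y x := by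
  obtain ⟨q, m, hq, ha, rfl, rfl⟩ := h
  exact ⟨_, m, hq.reverse, ha.reverse, by simp, by simp⟩

theorem Linked.left_notMem {D : Set V} {x y : V} (h : Linked D x y) : x ∉ D := by
  obtain ⟨q, m, -, ha, rfl, -⟩ := h
  exact ha.1 0 (by omega)

end Basic

section Spread

theorem IsZigzag.even_lt {V : Type*} [Lattice V] {q : ℕ → V} {n : ℕ} (h : IsZigzag q n)
    (h₀ : q 0 < q 1) :
    ∀ i < n, (Even i → q i < q (i + 1)) ∧ (¬Even i → q (i + 1) < q i) := by
  intro i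
  induction i with
  | zero => exact fun _ => ⟨fun _ => h₀, fun h => absurd Even.zero h⟩
  | succ i ih =>
    intro hi
    have ih := ih (by omega)
    rw [Nat.even_add_one, not_not]
    rcases h.2 i (by omega) with k | k
    · exact ⟨fun _ => k.2.1, fun he => absurd (ih.1 he) k.1.not_gt⟩
    · exact ⟨fun he => absurd (ih.2 he) k.1.not_gt, fun _ => k.2.1⟩

/-- A zigzag of odd length which turns at both of its ends closes up to a cycle. -/
theorem SimplyConnected.not_closes_up {V : Type*} [Lattice V] (sc : SimplyConnected V)
    {c : ℕ → V} {n : ℕ} (hc : IsZigzag c n) (hn : ¬Even n)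
    (h₁ : IsTurn (c (n - 1)) (c n) (c 0)) (h₂ : IsTurn (c n) (c 0) (c 1)) : False := by
  obtain ⟨m, rfl⟩ := Nat.not_even_iff_odd.mp hn
  refine sc (fun i => c (i % (2 * m + 2))) (m + 1) ⟨by omega, fun i => ?_, fun i => ?_⟩
  · simp [mul_add]
  · change IsTurn (c (i % (2 * m + 2))) (c ((i + 1) % (2 * m + 2))) (c ((i + 2) % (2 * m + 2)))
    have hi := Nat.mod_lt i (show 0 < 2 * m + 2 by omega)
    have h1 : 1 % (2 * m + 2) = 1 := Nat.mod_eq_of_lt (by omega)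
    rw [← Nat.mod_add_mod i _ 1, ← Nat.mod_add_mod i _ 2]
    generalize i % (2 * m + 2) = r at hi
    rcases lt_trichotomy r (2 * m) with hr | rfl | hr
    · rw [Nat.mod_eq_of_lt (by omega), Nat.mod_eq_of_lt (by omega)]
      exact hc.2 r (by omega)
    · rw [Nat.mod_eq_of_lt (by omega), Nat.mod_self]
      simpa using h₁
    · obtain rfl : r = 2 * m + 1 := by omega
      rw [Nat.mod_self, show 2 * m + 1 + 2 = 1 + (2 * m + 2) by omega, Nat.add_mod_right, h1]
      exact h₂

theorem SimplyConnected.dual {V : Type*} [Lattice V] (sc : SimplyConnected V) :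
    SimplyConnected Vᵒᵈ :=
  fun x n h => sc (fun i => OrderDual.ofDual (x i)) n ⟨h.1, h.2.1, fun i => (h.2.2 i).symm⟩

theorem SimplyConnected.incomparable_of_lt {V : Type*} [Lattice V] (sc : SimplyConnected V)
    {n : ℕ} (hn : 2 ≤ n)
    (ih : ∀ q : ℕ → V, IsZigzag q n → ¬q 0 ≤ q n ∧ ¬q n ≤ q 0)
    {q : ℕ → V} (hq : IsZigzag q (n + 1)) (h₀ : q 0 < q 1) :
    ¬q 0 ≤ q (n + 1) ∧ ¬q (n + 1) ≤ q 0 := by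
  have htail := ih _ (hq.drop 1)
  simp only [add_zero, add_comm 1 n] at htail
  have hinit := ih q (hq.mono (by omega))
  refine ⟨fun hle => ?_, fun hle => htail.2 (hle.trans h₀.le)⟩
  rcases hq.1 n (by omega) with hlast | hlast
  swap
  · exact hinit.1 (hle.trans hlast.le)
  have hodd : ¬Even (n + 1) := by
    rw [Nat.even_add_one, not_not]
    by_contra he
    exact ((hq.even_lt h₀ n (by omega)).2 he).not_gt hlast
  set a := q 1 ⊓ q (n + 1) with ha
  have ha1 : a < q 1 := inf_le_left.lt_of_ne fun h => htail.1 (inf_eq_left.mp h)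
  have haturn : IsTurn a (q 1) (q 2) :=
    IsTurn.of_between_left (hq.2 0 (by omega)) (Or.inl ⟨le_inf h₀.le hle, ha1⟩)
  have hp : IsZigzag (consSeq a fun i => q (1 + i)) n := by
    have := ((hq.drop 1).mono (m := n - 1) (by omega)).cons (Or.inl ha1) fun _ => haturn
    rwa [show n - 1 + 1 = n by omega] at this
  obtain ⟨k, rfl⟩ : ∃ k, n = k + 1 := ⟨n - 1, by omega⟩
  have hinc := ih _ hp
  have hk : consSeq a (fun i => q (1 + i)) (k + 1) = q (k + 1) := by
    simp [consSeq, add_comm]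
  rw [hk] at hinc
  set b := q (k + 1) ⊔ a with hb
  have hbturn : IsTurn (q (k + 1)) b a :=
    Or.inr ⟨left_lt_sup.mpr hinc.1, right_lt_sup.mpr hinc.2, rfl⟩
  have hb' : b ≤ q (k + 2) := sup_le hlast.le inf_le_right
  have hlast' : IsTurn b (q (k + 1)) (q k) :=
    IsTurn.of_between_left (IsTurn.symm (hq.2 k (by omega)))
      (Or.inr ⟨left_lt_sup.mpr hinc.1, hb'⟩)
  have hfirst : IsTurn b a (q 1) := by
    refine Or.inl ⟨right_lt_sup.mpr hinc.2, ha1, le_antisymm (le_inf le_sup_right inf_le_left) ?_⟩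
    rw [ha, inf_comm]
    exact inf_le_inf_left _ hb'
  have hc := hp.cons (a := b) (Or.inr (right_lt_sup.mpr hinc.2)) fun _ => hfirst
  refine sc.not_closes_up hc hodd ?_ ?_
  · obtain ⟨l, rfl⟩ : ∃ l, k = l + 1 := ⟨k - 1, by omega⟩
    simpa [consSeq, add_comm] using hlast'.symm
  · simpa [consSeq, add_comm] using hbturn

theorem SimplyConnected.zigzagsSpread {V : Type*} [Lattice V] (sc : SimplyConnected V) :
    ZigzagsSpread V := by
  intro q n hn
  induction n, hn using Nat.le_induction generalizing V with
  | base =>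
    intro hq
    rcases hq.2 0 le_rfl with ⟨h₁, h₂, h⟩ | ⟨h₁, h₂, h⟩
    · exact ⟨fun k => h₁.ne (h.trans (inf_eq_left.mpr k)),
        fun k => h₂.ne (h.trans (inf_eq_right.mpr k))⟩
    · exact ⟨fun k => h₂.ne' (h.trans (sup_eq_right.mpr k)),
        fun k => h₁.ne' (h.trans (sup_eq_left.mpr k))⟩
  | succ n hn ih =>
    intro hq
    rcases hq.1 0 (by omega) with h | h
    · exact sc.incomparable_of_lt hn (fun _ => ih sc _) hq h
    · exact (sc.dual.incomparable_of_lt hn (fun _ => ih sc.dual _) hq.toDual h).symm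

theorem ZigzagsSpread.dual {V : Type*} [Lattice V] (h : ZigzagsSpread V) : ZigzagsSpread Vᵒᵈ :=
  fun _ n hn hq => (h _ n hn hq.ofDual).symm

end Spread

section Link

theorem Linked.toDual {V : Type*} [Lattice V] {D : Set V} {x y : V} (h : Linked D x y) :
    Linked (V := Vᵒᵈ) (OrderDual.ofDual ⁻¹' D) (OrderDual.toDual x) (OrderDual.toDual y) := by
  obtain ⟨q, m, hq, ha, rfl, rfl⟩ := h
  exact ⟨_, m, hq.toDual, ⟨ha.1, fun i hi d hd => (ha.2 i hi _ hd).symm.imp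
    (fun h k => h k.symm) (fun h k => h k.symm)⟩, rfl, rfl⟩

theorem Linked.ofDual {V : Type*} [Lattice V] {D : Set V} {x y : V}
    (h : Linked (V := Vᵒᵈ) (OrderDual.ofDual ⁻¹' D) (OrderDual.toDual x) (OrderDual.toDual y)) :
    Linked D x y :=
  h.toDual

/-- If every element of `D` above `x` is above `z`, then links from `z` yield links from `x`. -/
theorem Linked.of_lt {V : Type*} [Lattice V] (hV : ZigzagsSpread V) {D : Set V} {x y z : V}
    (hxz : x < z) (h : ∀ d ∈ D, x ≤ d → z ≤ d) (hz : Linked D z y) : Linked D x y := by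
  classical
  obtain ⟨q, m, hq, ha, rfl, rfl⟩ := hz
  have hxD : x ∉ D := fun hx => hxz.not_ge (h x hx le_rfl)
  have avoid : ∀ k ≤ m, ∀ d ∈ D, x ≤ d → ¬d ≤ q k := by
    intro k hk d hd hxd hdk
    have hd0 := h d hd hxd
    match k with
    | 0 => exact ha.1 0 hk (le_antisymm hd0 hdk ▸ hd)
    | 1 => exact (ha.2 0 (by omega) d hd).1 ⟨hd0, hdk⟩
    | k + 2 => exact (hV q (k + 2) (by omega) (hq.mono hk)).1 (hd0.trans hdk)
  set k := Nat.findGreatest (fun k => x ≤ q k) m with hk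
  have hkm : k ≤ m := Nat.findGreatest_le m
  have hxk : x ≤ q k := Nat.findGreatest_spec (P := fun k => x ≤ q k) (Nat.zero_le m) hxz.le
  rcases hkm.eq_or_lt with hkm | hkm
  · rw [hkm] at hxk
    rcases hxk.eq_or_lt with e | hlt
    · exact ⟨_, 0, .const x, .const hxD, rfl, e⟩
    · refine ⟨_, 1, (IsZigzag.const (q m)).cons (Or.inl hlt) (by omega),
        (Avoids.const (ha.1 m le_rfl)).cons hxD fun d hd =>
          ⟨fun k => avoid m le_rfl d hd k.1 k.2,
            fun k => avoid m le_rfl d hd (hlt.le.trans k.1) (k.2.trans hlt.le)⟩, rfl, rfl⟩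
  have hnot : ¬x ≤ q (k + 1) :=
    Nat.findGreatest_is_greatest (P := fun k => x ≤ q k) (Nat.lt_succ_self k) hkm
  have hdown : q (k + 1) < q k := (hq.1 k hkm).resolve_left fun h => hnot (hxk.trans h.le)
  have hseg : ∀ u, q (k + 1) ≤ u → u ≤ q k →
      ∀ d ∈ D, ¬(u ≤ d ∧ d ≤ q (k + 1)) ∧ ¬(q (k + 1) ≤ d ∧ d ≤ u) := fun u hu hu' d hd =>
    ⟨fun e => (ha.2 k hkm d hd).2 ⟨hu.trans e.1, e.2.trans hdown.le⟩,
      fun e => (ha.2 k hkm d hd).2 ⟨e.1, e.2.trans hu'⟩⟩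
  have hturn : ∀ u, q (k + 1) < u → u ≤ q k → 1 ≤ m - (k + 1) →
      IsTurn u (q (k + 1)) (q (k + 1 + 1)) := fun u hu hu' hm =>
    IsTurn.of_between_left (hq.2 k (by omega)) (Or.inr ⟨hu, hu'⟩)
  have hqd := hq.drop (k + 1)
  have had := ha.drop (k := k + 1) (by omega)
  have hend : k + 1 + (m - (k + 1)) = m := by omega
  by_cases hle : q (k + 1) ≤ x
  · have hlt : q (k + 1) < x := hle.lt_of_not_ge hnot
    exact ⟨_, _, hqd.cons (Or.inr hlt) (hturn x hlt hxk),
      had.cons hxD (hseg x hle hxk), rfl, congrArg q hend⟩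
  · have hu : x ⊔ q (k + 1) ≤ q k := sup_le hxk hdown.le
    have hxu : x < x ⊔ q (k + 1) := left_lt_sup.mpr hle
    have hqu : q (k + 1) < x ⊔ q (k + 1) := right_lt_sup.mpr hnot
    refine ⟨_, _, (hqd.cons (Or.inr hqu) (hturn _ hqu hu)).cons (Or.inl hxu) fun _ =>
      Or.inr ⟨hxu, hqu, rfl⟩, (had.cons (fun hD => avoid k hkm.le _ hD le_sup_left hu)
        (hseg _ hqu.le hu)).cons hxD fun d hd =>
          ⟨fun e => avoid k hkm.le d hd e.1 (e.2.trans hu),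
            fun e => avoid k hkm.le d hd (hxu.le.trans e.1) (e.2.trans hxk)⟩, rfl, congrArg q hend⟩

theorem Linked.of_gt {V : Type*} [Lattice V] (hV : ZigzagsSpread V) {D : Set V} {x y z : V}
    (hxz : z < x) (h : ∀ d ∈ D, d ≤ x → d ≤ z) (hz : Linked D z y) : Linked D x y :=
  Linked.ofDual (Linked.of_lt (V := Vᵒᵈ) hV.dual hxz h hz.toDual)

/-- A zigzag leads from `z` into `D` and its first step lies between `z` and `a`. -/
def Anchored {V : Type*} [Lattice V] (D : Set V) (a z : V) : Prop :=
  ∃ (w : ℕ → V) (l : ℕ), 1 ≤ l ∧ IsZigzag w l ∧ w 0 = z ∧ w l ∈ D ∧ Between a (w 1) z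

theorem Anchored.of_between {V : Type*} [Lattice V] {D : Set V} {a d z : V} (hd : d ∈ D)
    (h : Between a d z) : Anchored D a z :=
  ⟨_, 1, le_rfl, (IsZigzag.const d).cons (a := z) (h.symm.imp And.left And.right) (by omega),
    rfl, hd, h⟩

theorem Anchored.of_turn {V : Type*} [Lattice V] {D : Set V} {a d u z : V} (hd : d ∈ D)
    (h : Between a u z) (ht : IsTurn z u d) : Anchored D a z :=
  ⟨_, 2, by omega, ((IsZigzag.const d).cons (a := u) ht.symm.lt_or_gt_left.symm (by omega)).cons
    ht.lt_or_gt_left fun _ => ht, rfl, hd, h⟩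

theorem Anchored.step {V : Type*} [Lattice V] {D : Set V} {a b c : V} (h : Anchored D a b)
    (ht : IsTurn a b c) : Anchored D b c := by
  obtain ⟨w, l, hl, hw, rfl, hD, hb⟩ := h
  have hc := ht.symm.lt_or_gt_left
  exact ⟨_, l + 1, by omega, hw.cons hc fun _ => (ht.of_between_left hb).symm, rfl, hD,
    between_of_lt_or_gt hc.symm⟩

/-- Links extend backwards over an edge unless `D` is anchored there. -/
theorem Linked.extend_or_anchored {V : Type*} [Lattice V] (hV : ZigzagsSpread V) {D : Set V}
    {x y z : V} (hxz : x < z ∨ z < x) (hz : Linked D z y) : Linked D x y ∨ Anchored D x z := by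
  have hzD := hz.left_notMem
  by_contra! hcon
  obtain ⟨hx, hanch⟩ := hcon
  rcases hxz with hxz | hxz
  · refine hx (Linked.of_lt hV hxz (fun d hd hxd => ?_) hz)
    by_contra hzd
    by_cases hdz : d ≤ z
    · exact hanch (.of_between hd (Or.inl ⟨hxd, hdz.lt_of_not_ge hzd⟩))
    · have h₁ : z ⊓ d < z := inf_lt_left.mpr hzd
      exact hanch (.of_turn hd (Or.inl ⟨le_inf hxz.le hxd, h₁⟩)
        (Or.inl ⟨h₁, inf_lt_right.mpr hdz, rfl⟩))
  · refine hx (Linked.of_gt hV hxz (fun d hd hdx => ?_) hz)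
    by_contra hdz
    by_cases hzd : z ≤ d
    · exact hanch (.of_between hd (Or.inr ⟨hzd.lt_of_not_ge hdz, hdx⟩))
    · have h₁ : z < z ⊔ d := left_lt_sup.mpr hdz
      exact hanch (.of_turn hd (Or.inr ⟨h₁, sup_le hxz.le hdx⟩)
        (Or.inr ⟨h₁, right_lt_sup.mpr hzd, rfl⟩))

theorem IsZigzag.linked_or_anchored {V : Type*} [Lattice V] (hV : ZigzagsSpread V) {D : Set V}
    {y : V} {x : ℕ → V} {n : ℕ} (hx : IsZigzag x n) :
    ∀ i < n, Linked D (x (i + 1)) y → Linked D (x 0) y ∨ Anchored D (x i) (x (i + 1)) := by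
  intro i
  induction i with
  | zero => exact fun hi h => h.extend_or_anchored hV (hx.1 0 hi)
  | succ i ih =>
    intro hi h
    rcases h.extend_or_anchored hV (hx.1 (i + 1) hi) with h | h
    · exact (ih (by omega) h).imp_right fun h => h.step (hx.2 i hi)
    · exact Or.inr h

/-- The elements which cannot be linked to `y` outside a closed set form a closed set. -/
theorem ZClosed.setOf_not_linked {M : Type*} [Lattice M] [BoundedOrder M]
    (hM : ZigzagsSpread M) {D : Set M} (hD : ZClosed D) (y : M) :
    ZClosed {x | ¬Linked D x y} := by
  refine ⟨fun h => h.left_notMem hD.1, fun h => h.left_notMem hD.2.1,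
    fun x n hx h₀ hn i hi hl => ?_⟩
  have hi₀ : i ≠ 0 := by rintro rfl; exact h₀ hl
  have hin : i ≠ n := by rintro rfl; exact hn hl
  obtain ⟨j, rfl⟩ := Nat.exists_eq_succ_of_ne_zero hi₀
  have hleft := (hx.linked_or_anchored hM j (by omega) hl).resolve_left h₀
  have e₁ : n - (n - (j + 2) + 1) = j + 1 := by omega
  have e₂ : n - (n - (j + 2)) = j + 2 := by omega
  have hright := hx.reverse.linked_or_anchored hM (D := D) (y := y) (n - (j + 2)) (by omega)
  rw [e₁, e₂] at hright
  have hright := (hright hl).resolve_left hn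
  obtain ⟨w, l, hl₁, hw, hw₀, hwD, hwb⟩ := hleft
  obtain ⟨v, m, hm₁, hv, hv₀, hvD, hvb⟩ := hright
  have ht : IsTurn (w 1) (v 0) (v 1) := by
    rw [hv₀]
    exact IsTurn.of_between (hx.2 j (by omega)) hwb hvb
  have hmem := hD.2.2 _ _ (hw.join hv (hw₀.trans hv₀.symm) ht) (by simpa using hwD)
    (by simpa [show ¬m = 0 by omega] using hvD) l (by omega)
  exact hl.left_notMem (by simpa [hw₀] using hmem)

end Link

section Closure

variable {M : Type*} [Lattice M] [BoundedOrder M]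

theorem subset_zcl (X : Set M) : X ⊆ zcl X := fun _ hx _ hA => hA.2 hx

theorem zcl_subset {X A : Set M} (hA : ZClosed A) (h : X ⊆ A) : zcl X ⊆ A :=
  fun _ hx => hx A ⟨hA, h⟩

theorem zClosed_zcl (X : Set M) : ZClosed (zcl X) :=
  ⟨fun _ hA => hA.1.1, fun _ hA => hA.1.2.1, fun x n hx h₀ hn i hi A hA =>
    hA.1.2.2 x n hx (h₀ A hA) (hn A hA) i hi⟩

theorem zcl_zcl (X : Set M) : zcl (zcl X) = zcl X :=
  (zcl_subset (zClosed_zcl X) subset_rfl).antisymm (subset_zcl _)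

theorem not_crosses_iff_avoids {p : ℕ → M} {n : ℕ} {B : Set M} :
    ¬Crosses p n B ↔ Avoids (zcl B) p n := by
  constructor
  · intro h
    have h₁ : ∀ i ≤ n, p i ∉ zcl B := fun i hi hp => h (Or.inl ⟨i, hi, hp⟩)
    refine ⟨h₁, fun i hi d hd => ?_⟩
    have hne : d ≠ p i := by rintro rfl; exact h₁ i hi.le hd
    have hne' : d ≠ p (i + 1) := by rintro rfl; exact h₁ (i + 1) hi hd
    exact ⟨fun k => h (Or.inr ⟨i, hi, d, hd, Or.inl ⟨k.1.lt_of_ne' hne, k.2.lt_of_ne hne'⟩⟩),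
      fun k => h (Or.inr ⟨i, hi, d, hd, Or.inr ⟨k.1.lt_of_ne' hne', k.2.lt_of_ne hne⟩⟩)⟩
  · rintro h (⟨i, hi, hp⟩ | ⟨i, hi, d, hd, k | k⟩)
    · exact h.1 i hi hp
    · exact (h.2 i hi d hd).1 ⟨k.1.le, k.2.le⟩
    · exact (h.2 i hi d hd).2 ⟨k.1.le, k.2.le⟩

theorem indep_iff_not_linked {A B C : Set M} :
    Indep A B C ↔ ∀ a ∈ A, ∀ c ∈ C, ¬Linked (zcl B) a c := by
  constructor
  · rintro h a ha c hc ⟨p, n, hp, hav, rfl, rfl⟩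
    exact not_crosses_iff_avoids.mpr hav (h p n hp ha hc)
  · intro h p n hp ha hc
    by_contra hcr
    exact h _ ha _ hc ⟨p, n, hp, not_crosses_iff_avoids.mp hcr, rfl, rfl⟩

end Closure

/-- (Corollary 4.11) `A` is independent from `C` over `B` if and only if
`cl(A ∪ B)` is independent from `cl(B ∪ C)` over `cl B`. -/
theorem indep_iff_indep_zcl {N : ℕ} {M : Type*}
    [Lattice M] [BoundedOrder M] (P : FreePseudospace N M)
    (A B C : Set M) :
    Indep A B C ↔ Indep (zcl (A ∪ B)) (zcl B) (zcl (B ∪ C)) := by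
  have hM := P.simplyConnected.zigzagsSpread
  have hD := zClosed_zcl B
  rw [indep_iff_not_linked, indep_iff_not_linked, zcl_zcl]
  refine ⟨fun h => ?_, fun h a ha c hc => h a (subset_zcl _ (Or.inl ha)) c
    (subset_zcl _ (Or.inr hc))⟩
  have hleft : ∀ c ∈ C, ∀ x ∈ zcl (A ∪ B), ¬Linked (zcl B) x c := fun c hc =>
    zcl_subset (hD.setOf_not_linked hM c) (Set.union_subset (fun a ha => h a ha c hc)
      fun b hb hl => hl.left_notMem (subset_zcl B hb))
  intro x hx y hy hl
  exact zcl_subset (hD.setOf_not_linked hM x) (Set.union_subset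
    (fun b hb hl => hl.left_notMem (subset_zcl B hb))
    fun c hc hl => hleft c hc x hx hl.symm) hy hl.symm
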